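/- Let d, m ≥ 1, r⃗ = (r_1,…,r_m) ∈ (0,∞)^m, q ∈ (0,∞), and C_T ≥ 0. Suppose h : ℝ^d → ℂ is measurable, f_j : ℝ^d → ℂ are measurable with |f_j|^{r_j} locally integrable (1 ≤ j ≤ m), 𝒮 is a sparse collection of cubes, and |h(x)| ≤ C_T (∑_{Q∈𝒮} (∏_{j=1}^m ⟨f_j⟩_{r_j,Q})^q 1_Q(x))^{1/q} for almost every x ∈ ℝ^d. Then there is a constant C depending only on d, m, q such that for every measurable g : ℝ^d → ℂ with |g|^q locally integrable, ‖h·g‖_{L^q(ℝ^d)} ≤ C · C_T · ‖M_{(r_1,…,r_m,q)}(f_1,…,f_m,g)‖_{L^q(ℝ^d)}. -/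

import Mathlib

open MeasureTheory ENNReal

noncomputable section

structure Cube (d : ℕ) where
  corner : Fin d → ℝ
  side : ℝ
  side_pos : 0 < side

namespace Cube
def set {d : ℕ} (Q : Cube d) : Set (Fin d → ℝ) :=
  {x | ∀ i, Q.corner i ≤ x i ∧ x i < Q.corner i + Q.side}
def vol {d : ℕ} (Q : Cube d) : ℝ≥0∞ := volume Q.set
def IsDyadic {d : ℕ} (Q : Cube d) : Prop :=
  ∃ (k : ℤ) (n : Fin d → ℤ), Q.side = (2:ℝ) ^ (-k) ∧ ∀ i, Q.corner i = (2:ℝ) ^ (-k) * (n i : ℝ)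
end Cube

def IsSparse {d : ℕ} (S : Set (Cube d)) : Prop :=
  ∃ E : Cube d → Set (Fin d → ℝ),
    (∀ Q ∈ S, MeasurableSet (E Q) ∧ E Q ⊆ Q.set ∧ Q.vol ≤ 2 * volume (E Q)) ∧
    S.PairwiseDisjoint E

def eNorm {α : Type*} [MeasurableSpace α] (p : ℝ≥0∞) (μ : Measure α) (F : α → ℝ≥0∞) : ℝ≥0∞ :=
  if p = ∞ then essSup F μ else (∫⁻ x, F x ^ p.toReal ∂μ) ^ (1 / p.toReal)

def nn {α : Type*} (f : α → ℂ) : α → ℝ≥0∞ := fun x => (‖f x‖₊ : ℝ≥0∞)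

def avg {d : ℕ} (r : ℝ≥0∞) (F : (Fin d → ℝ) → ℝ≥0∞) (Q : Cube d) : ℝ≥0∞ :=
  if r = ∞ then essSup F (volume.restrict Q.set)
  else ((∫⁻ x in Q.set, F x ^ r.toReal) / Q.vol) ^ (1 / r.toReal)

def maximal {d k : ℕ} (r : Fin k → ℝ≥0∞) (F : Fin k → (Fin d → ℝ) → ℝ≥0∞)
    (x : Fin d → ℝ) : ℝ≥0∞ :=
  ⨆ (Q : Cube d) (_ : x ∈ Q.set), ∏ j, avg (r j) (F j) Q

def maximalX {d k : ℕ} (r : Fin k → ℝ≥0∞) (ρ : ℝ≥0∞) (F : Fin k → (Fin d → ℝ) → ℝ≥0∞)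
    (G : (Fin d → ℝ) → ℝ≥0∞) (x : Fin d → ℝ) : ℝ≥0∞ :=
  ⨆ (Q : Cube d) (_ : x ∈ Q.set), (∏ j, avg (r j) (F j) Q) * avg ρ G Q

def wNorm {d : ℕ} (p : ℝ≥0∞) (w : (Fin d → ℝ) → ℝ) (F : (Fin d → ℝ) → ℝ≥0∞) : ℝ≥0∞ :=
  eNorm p volume (fun x => F x * ENNReal.ofReal (w x))

def aConst {d m : ℕ} (p r : Fin m → ℝ≥0∞) (s : ℝ≥0∞)
    (w : Fin m → (Fin d → ℝ) → ℝ) : ℝ≥0∞ :=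
  ⨆ Q : Cube d,
    (∏ j, avg ((r j)⁻¹ - (p j)⁻¹)⁻¹ (fun x => ENNReal.ofReal (w j x)⁻¹) Q) *
      avg ((∑ j, (p j)⁻¹) - s⁻¹)⁻¹ (fun x => ENNReal.ofReal (∏ j, w j x)) Q

def latAvg {d : ℕ} {Ω : Type*} (r : ℝ≥0∞) (f : (Fin d → ℝ) → Ω → ℂ) (Q : Cube d) (ω : Ω) : ℝ≥0∞ :=
  ((∫⁻ y in Q.set, (‖f y ω‖₊ : ℝ≥0∞) ^ r.toReal) / Q.vol) ^ (1 / r.toReal)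

def latMax {d m : ℕ} {Ω : Type*} (r : Fin m → ℝ≥0∞) (D : Finset (Cube d))
    (f : Fin m → (Fin d → ℝ) → Ω → ℂ) (x : Fin d → ℝ) (ω : Ω) : ℝ≥0∞ :=
  ⨆ Q ∈ D, ⨆ (_ : x ∈ Cube.set Q), ∏ j, latAvg (r j) (f j) Q ω

def latMaxX {d m : ℕ} {Ω : Type*} (r : Fin m → ℝ≥0∞) (ρ : ℝ≥0∞) (D : Finset (Cube d))
    (f : Fin m → (Fin d → ℝ) → Ω → ℂ) (g : (Fin d → ℝ) → Ω → ℂ)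
    (x : Fin d → ℝ) (ω : Ω) : ℝ≥0∞ :=
  ⨆ Q ∈ D, ⨆ (_ : x ∈ Cube.set Q), (∏ j, latAvg (r j) (f j) Q ω) * latAvg ρ g Q ω

def MemLinftyC {d : ℕ} (f : (Fin d → ℝ) → ℂ) : Prop :=
  Measurable f ∧ (∃ M : ℝ, ∀ x, ‖f x‖ ≤ M) ∧ Bornology.IsBounded (Function.support f)

def SimpleLinftyC {d : ℕ} (f : (Fin d → ℝ) → ℂ) : Prop :=
  Measurable f ∧ (Set.range f).Finite ∧ Bornology.IsBounded (Function.support f)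

def PairSimple {d : ℕ} {Ω : Type*} [MeasurableSpace Ω] (f : (Fin d → ℝ) → Ω → ℂ) : Prop :=
  Measurable (Function.uncurry f) ∧ (Set.range (Function.uncurry f)).Finite ∧
    ∃ B : Set (Fin d → ℝ), Bornology.IsBounded B ∧ ∀ x ∉ B, ∀ ω, f x ω = 0

def VecSimple {d : ℕ} {Ω : Type*} [MeasurableSpace Ω] (f : (Fin d → ℝ) → Ω → ℂ) : Prop :=
  ∃ (N : ℕ) (A : Fin N → Set (Fin d → ℝ)) (ξ : Fin N → Ω → ℂ),
    (∀ i, MeasurableSet (A i)) ∧ (∀ i, Bornology.IsBounded (A i)) ∧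
    (∀ i, Measurable (ξ i)) ∧ (∃ M : ℝ, ∀ i ω, ‖ξ i ω‖ ≤ M) ∧
    ∀ x ω, f x ω = ∑ i, (A i).indicator (fun _ => ξ i ω) x

theorem Cube.set_eq_pi {d : ℕ} (Q : Cube d) :
    Q.set = Set.pi Set.univ (fun i => Set.Ico (Q.corner i) (Q.corner i + Q.side)) := by
  ext x
  simp [Cube.set, Set.mem_pi]

theorem Cube.measurableSet_set {d : ℕ} (Q : Cube d) : MeasurableSet Q.set := by
  rw [Q.set_eq_pi]
  exact MeasurableSet.univ_pi fun i => measurableSet_Ico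

theorem Cube.vol_eq {d : ℕ} (Q : Cube d) : Q.vol = ENNReal.ofReal Q.side ^ d := by
  rw [Cube.vol, Q.set_eq_pi, Real.volume_pi_Ico]
  simp

theorem Cube.vol_ne_zero {d : ℕ} (Q : Cube d) : Q.vol ≠ 0 := by
  rw [Q.vol_eq]
  exact pow_ne_zero _ (by simpa using Q.side_pos)

theorem Cube.vol_ne_top {d : ℕ} (Q : Cube d) : Q.vol ≠ ∞ := by
  rw [Q.vol_eq]
  exact ENNReal.pow_ne_top ENNReal.ofReal_ne_top

/-- pointwise sparse domination implies domination in form by the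
multisublinear maximal operator. -/
theorem statement2 (d m : ℕ) (hd : 1 ≤ d) (hm : 1 ≤ m)
    (q : ℝ≥0∞) (hq : 0 < q) (hq' : q ≠ ∞) :
    ∃ C : ℝ≥0∞, 0 < C ∧ C ≠ ∞ ∧
      ∀ (r : Fin m → ℝ≥0∞), (∀ j, 0 < r j ∧ r j ≠ ∞) →
      ∀ (C_T : ℝ≥0∞) (h : (Fin d → ℝ) → ℂ) (f : Fin m → (Fin d → ℝ) → ℂ)
        (S : Set (Cube d)) (g : (Fin d → ℝ) → ℂ),
        Measurable h →
        (∀ j, Measurable (f j)) →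
        (∀ j (Q : Cube d), ∫⁻ x in Q.set, nn (f j) x ^ (r j).toReal < ∞) →
        IsSparse S →
        (∀ᵐ x, nn h x ≤ C_T *
          (∑' Q : S, (Q : Cube d).set.indicator
              (fun _ => (∏ j, avg (r j) (nn (f j)) (Q : Cube d)) ^ q.toReal) x)
            ^ (1 / q.toReal)) →
        Measurable g →
        (∀ Q : Cube d, ∫⁻ x in Q.set, nn g x ^ q.toReal < ∞) →
        eNorm q volume (fun x => nn h x * nn g x) ≤
          C * C_T * eNorm q volume (maximalX r q (fun j => nn (f j)) (nn g)) := by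
  have ht : 0 < q.toReal := ENNReal.toReal_pos hq.ne' hq'
  refine ⟨2 ^ (1 / q.toReal), ENNReal.rpow_pos (by norm_num) (by norm_num),
    ENNReal.rpow_ne_top_of_nonneg (by positivity) (by norm_num), ?_⟩
  intro r hr C_T h f S g _ hf _ hS hdom hg _
  obtain ⟨E, hE, hdisj⟩ := hS
  set t := q.toReal with htdef
  set A : Cube d → ℝ≥0∞ := fun Q => ∏ j, avg (r j) (nn (f j)) Q with hA
  set M := maximalX r q (fun j => nn (f j)) (nn g) with hM
  have hEpos : ∀ Q ∈ S, 0 < volume (E Q) := by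
    intro Q hQ
    rw [pos_iff_ne_zero]
    intro h0
    have := (hE Q hQ).2.2
    rw [h0, mul_zero] at this
    exact Q.vol_ne_zero (le_antisymm this zero_le)
  have hdisj' : Pairwise (Function.onFun Disjoint (fun Q : S => E Q)) := by
    intro a b hab
    exact hdisj a.2 b.2 (fun hh => hab (Subtype.ext hh))
  have hcount : Countable S := by
    have h1 := Measure.countable_meas_pos_of_disjoint_iUnion (μ := (volume : Measure (Fin d → ℝ)))
      (As := fun Q : S => E Q) (fun Q => (hE Q Q.2).1) hdisj'
    have h2 : {i : S | 0 < volume (E i)} = Set.univ := by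
      exact Set.eq_univ_of_forall fun Q => hEpos Q Q.2
    rw [h2] at h1
    exact Set.countable_univ_iff.mp h1
  have hgm : Measurable (fun x => nn g x ^ t) := by
    unfold nn
    fun_prop
  have hterm : ∀ Q : Cube d, Measurable (fun x => Q.set.indicator (fun _ => A Q ^ t) x) :=
    fun Q => measurable_const.indicator Q.measurableSet_set
  -- the integral of a single term
  have hone : ∀ Q ∈ S, ∫⁻ x, Q.set.indicator (fun _ => A Q ^ t) x * nn g x ^ t
      ≤ 2 * ∫⁻ x in E Q, M x ^ t := by
    intro Q hQ
    have e1 : (fun x => Q.set.indicator (fun _ => A Q ^ t) x * nn g x ^ t)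
        = Q.set.indicator (fun x => A Q ^ t * nn g x ^ t) := by
      ext x
      by_cases hx : x ∈ Q.set <;> simp [hx]
    rw [e1, lintegral_indicator Q.measurableSet_set, lintegral_const_mul _ hgm]
    have e2 : (∫⁻ x in Q.set, nn g x ^ t) = avg q (nn g) Q ^ t * Q.vol := by
      rw [avg, if_neg hq', ← htdef, ← ENNReal.rpow_mul, one_div_mul_cancel ht.ne',
        ENNReal.rpow_one, ENNReal.div_mul_cancel Q.vol_ne_zero Q.vol_ne_top]
    rw [e2, ← mul_assoc, ← ENNReal.mul_rpow_of_nonneg _ _ ht.le]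
    calc (A Q * avg q (nn g) Q) ^ t * Q.vol
        ≤ (A Q * avg q (nn g) Q) ^ t * (2 * volume (E Q)) := by
          gcongr; exact (hE Q hQ).2.2
      _ = 2 * ∫⁻ x in E Q, (A Q * avg q (nn g) Q) ^ t := by
          rw [setLIntegral_const]; ring
      _ ≤ 2 * ∫⁻ x in E Q, M x ^ t := by
          refine mul_le_mul_right ?_ 2
          refine setLIntegral_mono' (hE Q hQ).1 ?_
          intro x hx
          refine ENNReal.rpow_le_rpow ?_ ht.le
          exact le_iSup₂_of_le (f := fun (Q : Cube d) (_ : x ∈ Q.set) =>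
            (∏ j, avg (r j) (nn (f j)) Q) * avg q (nn g) Q) Q ((hE Q hQ).2.1 hx) le_rfl
  have hmain : ∫⁻ x, (nn h x * nn g x) ^ t ≤ C_T ^ t * (2 * ∫⁻ x, M x ^ t) := by
    calc ∫⁻ x, (nn h x * nn g x) ^ t
        ≤ ∫⁻ x, C_T ^ t * ∑' Q : S, ((Q : Cube d).set.indicator (fun _ => A Q ^ t) x
            * nn g x ^ t) := by
          refine lintegral_mono_ae ?_
          filter_upwards [hdom] with x hx
          rw [ENNReal.mul_rpow_of_nonneg _ _ ht.le, ENNReal.tsum_mul_right, ← mul_assoc]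
          gcongr
          refine (ENNReal.rpow_le_rpow hx ht.le).trans (le_of_eq ?_)
          rw [ENNReal.mul_rpow_of_nonneg _ _ ht.le, ← ENNReal.rpow_mul,
            one_div_mul_cancel ht.ne', ENNReal.rpow_one]
      _ = C_T ^ t * ∑' Q : S, ∫⁻ x, ((Q : Cube d).set.indicator (fun _ => A Q ^ t) x
            * nn g x ^ t) := by
          have hm1 : ∀ Q : S, Measurable (fun x => (Q : Cube d).set.indicator
              (fun _ => A Q ^ t) x * nn g x ^ t) := fun Q => (hterm Q).mul hgm
          rw [lintegral_const_mul _ (Measurable.tsum hm1),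
            lintegral_tsum fun Q : S => (hm1 Q).aemeasurable]
      _ ≤ C_T ^ t * ∑' Q : S, 2 * ∫⁻ x in E Q, M x ^ t := by
          gcongr with Q
          exact hone Q Q.2
      _ = C_T ^ t * (2 * ∫⁻ x in ⋃ Q : S, E Q, M x ^ t) := by
          rw [ENNReal.tsum_mul_left, lintegral_iUnion (fun Q : S => (hE Q Q.2).1) hdisj']
      _ ≤ C_T ^ t * (2 * ∫⁻ x, M x ^ t) := by
          gcongr
          exact Measure.restrict_le_self
  rw [eNorm, eNorm, if_neg hq', if_neg hq', ← htdef]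
  refine (ENNReal.rpow_le_rpow hmain (by positivity)).trans (le_of_eq ?_)
  have hi : 0 ≤ 1 / t := by positivity
  rw [ENNReal.mul_rpow_of_nonneg _ _ hi, ENNReal.mul_rpow_of_nonneg _ _ hi, ← ENNReal.rpow_mul,
    mul_one_div_cancel ht.ne', ENNReal.rpow_one]
  ring

end
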